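/- arXiv:2401.05046 — 5 statements merged into one kernel-verified Lean document; each statement's English description precedes it below -/
import Mathlib

section
/- Let G be a finitely generated virtually abelian group with finite generating set S, let N ⊴_fin G be a torsion-free abelian normal subgroup of finite index, let φ ∈ End(G) satisfy φ(N) ⊆ N, and let [g_0]_φ be a fixed φ-twisted conjugacy class of G. Then β_{[g_0]_φ ⊂ G}^S(r) = Θ(r^k) as r → ∞, where k = max{ rank(Id_N − (τ_g ∘ φ)|_N) : gN ∈ G/N and [g_0]_φ ∩ p^{-1}(gN) ≠ ∅ }, with p : G → G/N the canonical projection. In particular every twisted conjugacy class of G grows polynomially. -/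
open Filter Topology
open scoped Pointwise NNReal

/-- The ball of radius `r` in a group `G` with respect to a generating set `S`:
elements expressible as a product of at most `r` elements of `S ∪ S⁻¹`. -/
def ball {G : Type*} [Group G] (S : Set G) (r : ℕ) : Set G :=
  {g | ∃ l : List G, l.length ≤ r ∧ (∀ x ∈ l, x ∈ S ∪ S⁻¹) ∧ l.prod = g}

/-- `x` and `y` are `φ`-twisted conjugate: `∃ z, x = z * y * (φ z)⁻¹`. -/
def TwistedConj {G : Type*} [Group G] (φ : G →* G) (x y : G) : Prop :=
  ∃ z : G, x = z * y * (φ z)⁻¹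

/-- The `φ`-twisted conjugacy class of `g`. -/
def twistedConjClass {G : Type*} [Group G] (φ : G →* G) (g : G) : Set G :=
  {x | TwistedConj φ x g}

/-- `f = Θ(g)` as `r → ∞`: there are `c₁, c₂ > 0` and `n₀ ∈ ℕ_{>0}` with
`c₁ g(r) ≤ f(r) ≤ c₂ g(r)` for all `r ≥ n₀`. -/
def IsThetaNat (f g : ℕ → ℕ) : Prop :=
  ∃ c₁ c₂ : ℝ, 0 < c₁ ∧ 0 < c₂ ∧ ∃ n₀ : ℕ, 0 < n₀ ∧
    ∀ r : ℕ, n₀ ≤ r → c₁ * (g r : ℝ) ≤ (f r : ℝ) ∧ (f r : ℝ) ≤ c₂ * (g r : ℝ)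

/-- The rank of a subgroup `H` of `G`: the largest `n` such that the free abelian group
`ℤⁿ` embeds into `H`. For a finitely generated free abelian group this is its rank. -/
noncomputable def grpRank {G : Type*} [Group G] (H : Subgroup G) : ℕ :=
  sSup {n : ℕ | ∃ f : Multiplicative (Fin n → ℤ) →* G, Function.Injective f ∧ ∀ v, f v ∈ H}

/-- The image of the endomorphism `Id_N - (τ_g ∘ φ)|_N` of `N`, written multiplicatively:
the subgroup generated by `{x * (g * φ x * g⁻¹)⁻¹ : x ∈ N}` (this set is already a subgroup
when `N` is abelian, normal and `φ`-invariant). -/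
def twistImage {G : Type*} [Group G] (φ : G →* G) (N : Subgroup G) (g : G) : Subgroup G :=
  Subgroup.closure {y | ∃ x ∈ N, y = x * (g * φ x * g⁻¹)⁻¹}

/-- The minimum over the cosets `gN ∈ G/N` of `rank(Id_N - (τ_g ∘ φ)|_N)`. -/
noncomputable def minTwistRank {G : Type*} [Group G] (φ : G →* G) (N : Subgroup G) : ℕ :=
  sInf {m : ℕ | ∃ g : G, m = grpRank (twistImage φ N g)}

/-- The subset growth of `U` in `G` with respect to `S`: `#(U ∩ B_G^S(r))`. -/
noncomputable def subsetGrowth {G : Type*} [Group G] (U : Set G) (S : Set G) (r : ℕ) : ℕ :=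
  Nat.card ↥(U ∩ ball S r)

/-! ### Balls in the word metric -/

theorem ball_mul_mem {G : Type*} [Group G] {S : Set G} {m n : ℕ} {a b : G}
    (ha : a ∈ ball S m) (hb : b ∈ ball S n) : a * b ∈ ball S (m + n) := by
  obtain ⟨l, hl, hlS, rfl⟩ := ha
  obtain ⟨l', hl', hlS', rfl⟩ := hb
  refine ⟨l ++ l', by simp; omega, fun x hx => ?_, by simp⟩
  rcases List.mem_append.1 hx with h | h
  exacts [hlS x h, hlS' x h]

theorem ball_mono {G : Type*} [Group G] {S : Set G} {m n : ℕ} (h : m ≤ n) :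
    ball S m ⊆ ball S n :=
  fun _ ⟨l, hl, hlS, hg⟩ => ⟨l, hl.trans h, hlS, hg⟩

theorem one_mem_ball {G : Type*} [Group G] (S : Set G) (r : ℕ) : (1 : G) ∈ ball S r :=
  ⟨[], by simp, by simp, by simp⟩

theorem pow_mem_ball_mul {G : Type*} [Group G] {S : Set G} {m : ℕ} {a : G}
    (ha : a ∈ ball S m) (k : ℕ) : a ^ k ∈ ball S (k * m) := by
  induction k with
  | zero => simpa using one_mem_ball S 0
  | succ k ih => rw [pow_succ, Nat.succ_mul]; exact ball_mul_mem ih ha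

theorem exists_mem_ball {G : Type*} [Group G] {S : Set G} (hS : Subgroup.closure S = ⊤) (g : G) :
    ∃ L, g ∈ ball S L := by
  have hg : g ∈ Submonoid.closure (S ∪ S⁻¹) := by
    rw [← Subgroup.closure_toSubmonoid, hS]; trivial
  obtain ⟨l, hl, hg⟩ := Submonoid.exists_list_of_mem_closure hg
  exact ⟨l.length, l, le_rfl, hl, hg⟩

theorem finite_ball {G : Type*} [Group G] {S : Set G} (hS : S.Finite) (r : ℕ) :
    (ball S r).Finite := by
  induction r with
  | zero =>
    refine (Set.finite_singleton 1).subset ?_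
    rintro g ⟨l, hl, -, rfl⟩
    simp [List.length_eq_zero_iff.1 (Nat.le_zero.1 hl)]
  | succ r ih =>
    refine (((hS.union hS.inv).mul ih).union (Set.finite_singleton 1)).subset ?_
    rintro g ⟨l, hl, hlS, rfl⟩
    cases l with
    | nil => simp
    | cons s l =>
      rw [List.prod_cons]
      exact Or.inl (Set.mul_mem_mul (hlS s (by simp))
        ⟨l, by simpa using hl, fun x hx => hlS x (by simp [hx]), rfl⟩)

/-- A homomorphism from `ℤⁿ` sends boxes of side `m` into balls of radius `O(m)`. -/
theorem exists_box_mem_ball {G : Type*} [Group G] {S : Set G} (hS : Subgroup.closure S = ⊤)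
    {n : ℕ} (F : Multiplicative (Fin n → ℤ) →* G) :
    ∃ L : ℕ, ∀ (m : ℕ) (v : Fin n → ℕ), (∀ i, v i ≤ m) →
      F (Multiplicative.ofAdd fun i => (v i : ℤ)) ∈ ball S (m * L) := by
  choose L hL using fun i => exists_mem_ball hS (F (Multiplicative.ofAdd (Pi.single i 1)))
  refine ⟨∑ i, L i, fun m v hv => ?_⟩
  have key (s : Finset (Fin n)) :
      F (Multiplicative.ofAdd (∑ i ∈ s, v i • Pi.single i (1 : ℤ))) ∈
        ball S (∑ i ∈ s, v i * L i) := by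
    induction s using Finset.induction_on with
    | empty => simpa using one_mem_ball S 0
    | insert i s hi ih =>
      rw [Finset.sum_insert hi, Finset.sum_insert hi, ofAdd_add, map_mul, ofAdd_nsmul, map_pow]
      exact ball_mul_mem (pow_mem_ball_mul (hL i) _) ih
  have hv' : (∑ i, v i • Pi.single i (1 : ℤ) : Fin n → ℤ) = fun i => (v i : ℤ) := by
    ext j
    simp [Finset.sum_apply, Pi.single_apply]
  have h := key Finset.univ
  rw [hv'] at h
  refine ball_mono ?_ h
  rw [Finset.mul_sum]
  exact Finset.sum_le_sum fun i _ => Nat.mul_le_mul_right _ (hv i)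

/-- A subset containing a translate of an embedded `ℤⁿ` grows at least like `rⁿ`. -/
theorem exists_mul_pow_le_subsetGrowth {G : Type*} [Group G] {S : Set G} (hSfin : S.Finite)
    (hS : Subgroup.closure S = ⊤) {n : ℕ} (F : Multiplicative (Fin n → ℤ) →* G)
    (hF : Function.Injective F) {U : Set G} {h : G} (hU : ∀ v, F v * h ∈ U) :
    ∃ c : ℝ, 0 < c ∧ ∃ n₀ : ℕ, ∀ r : ℕ, n₀ ≤ r → c * (r : ℝ) ^ n ≤ subsetGrowth U S r := by
  obtain ⟨L, hL⟩ := exists_box_mem_ball hS F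
  obtain ⟨l, hl⟩ := exists_mem_ball hS h
  refine ⟨(1 / (2 * (L + 1))) ^ n, by positivity, 2 * l, fun r hr => ?_⟩
  set m := (r - l) / (L + 1)
  have hmul : m * (L + 1) ≤ r - l := Nat.div_mul_le_self _ _
  have hlt : r - l < (L + 1) * (m + 1) := Nat.lt_mul_div_succ _ (Nat.succ_pos L)
  have hcard : (m + 1) ^ n ≤ subsetGrowth U S r := by
    have hfin : Finite ↥(U ∩ ball S r) := ((finite_ball hSfin r).inter_of_right U).to_subtype
    let f : (Fin n → Fin (m + 1)) → ↥(U ∩ ball S r) := fun v =>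
      ⟨F (Multiplicative.ofAdd fun i => ((v i : ℕ) : ℤ)) * h, hU _,
        ball_mono (by nlinarith [Nat.sub_add_cancel (show l ≤ r by omega)])
          (ball_mul_mem (hL m (fun i => v i) fun i => Nat.lt_succ_iff.1 (v i).2) hl)⟩
    have hf : Function.Injective f := by
      intro v w hvw
      have h1 := hF (mul_right_cancel (congrArg Subtype.val hvw))
      funext i
      have h2 := congrFun (Multiplicative.ofAdd.injective h1) i
      exact Fin.ext (by exact_mod_cast h2)
    simpa [subsetGrowth] using Nat.card_le_card_of_injective f hf
  have hr' : (1 / (2 * (L + 1)) : ℝ) * r ≤ m + 1 := by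
    rw [div_mul_eq_mul_div, one_mul, div_le_iff₀ (by positivity)]
    have : r ≤ (m + 1) * (2 * (L + 1)) := by
      nlinarith [Nat.sub_add_cancel (show l ≤ r by omega)]
    exact_mod_cast this
  calc (1 / (2 * (L + 1)) : ℝ) ^ n * (r : ℝ) ^ n = (1 / (2 * (L + 1)) * r : ℝ) ^ n := by
        rw [mul_pow]
    _ ≤ ((m : ℝ) + 1) ^ n := pow_le_pow_left₀ (by positivity) hr' n
    _ ≤ subsetGrowth U S r := by exact_mod_cast hcard

/-! ### Finite index subgroups are undistorted -/

/-- A homomorphism to `ℤ` defined on a finite index normal subgroup grows at most linearly in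
the word length of the ambient group. -/
theorem exists_abs_le_of_mem_ball {G : Type*} [Group G] {S : Set G} (hSfin : S.Finite)
    (N : Subgroup G) [N.Normal] [N.FiniteIndex] (f : G → ℤ)
    (hf : ∀ a ∈ N, ∀ b ∈ N, f (a * b) = f a + f b) :
    ∃ C : ℕ, ∀ r : ℕ, ∀ x ∈ N, x ∈ ball S r → |f x| ≤ C * (r + 1) := by
  let rep : G ⧸ N → G := Quotient.out
  have hrep (q : G ⧸ N) : (rep q : G ⧸ N) = q := Quotient.out_eq' q
  have hrepN (g : G) : (rep g)⁻¹ * g ∈ N := QuotientGroup.eq.1 (hrep g)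
  have hT : (Set.range fun p : (G ⧸ N) × ↥(S ∪ S⁻¹) =>
      (f ((rep (p.2 * rep p.1 : G))⁻¹ * (p.2 * rep p.1))).natAbs).Finite := by
    have := (hSfin.union hSfin.inv).to_subtype
    exact Set.finite_range _
  obtain ⟨C, hC⟩ := hT.bddAbove
  have hC' (q : G ⧸ N) (s : G) (hs : s ∈ S ∪ S⁻¹) :
      |f ((rep (s * rep q : G))⁻¹ * (s * rep q))| ≤ C := by
    have h := hC ⟨(q, ⟨s, hs⟩), rfl⟩
    rw [Int.abs_eq_natAbs]
    exact_mod_cast h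
  have key (l : List G) (hl : ∀ x ∈ l, x ∈ S ∪ S⁻¹) :
      |f ((rep l.prod)⁻¹ * l.prod)| ≤ C * l.length + |f ((rep (1 : G))⁻¹)| := by
    induction l with
    | nil => simp
    | cons s l ih =>
      have hq : ((s * rep (l.prod : G) : G) : G ⧸ N) = ((s * l.prod : G) : G ⧸ N) := by
        rw [QuotientGroup.mk_mul, hrep, QuotientGroup.mk_mul]
      have h1 := hC' (l.prod : G) s (hl s (by simp))
      have h2 := ih fun x hx => hl x (by simp [hx])
      have h3 : (rep ((s :: l).prod : G))⁻¹ * (s :: l).prod =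
          ((rep (s * rep (l.prod : G) : G))⁻¹ * (s * rep (l.prod : G))) *
            ((rep (l.prod : G))⁻¹ * l.prod) := by
        rw [hq, List.prod_cons]; group
      rw [h3, hf _ (hrepN _) _ (hrepN _)]
      refine (abs_add_le _ _).trans ?_
      push_cast [List.length_cons]
      linarith
  refine ⟨C + (f (rep (1 : G))).natAbs + (f (rep (1 : G))⁻¹).natAbs, fun r x hx hxr => ?_⟩
  obtain ⟨l, hl, hlS, rfl⟩ := hxr
  have h1 := key l hlS
  have hq : ((l.prod : G) : G ⧸ N) = ((1 : G) : G ⧸ N) := by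
    rw [QuotientGroup.mk_one]; exact (QuotientGroup.eq_one_iff _).2 hx
  rw [hq] at h1
  have h1N : rep (1 : G) ∈ N := (QuotientGroup.eq_one_iff _).1 (by rw [hrep, QuotientGroup.mk_one])
  have h2 : f l.prod = f (rep (1 : G)) + f ((rep (1 : G))⁻¹ * l.prod) := by
    rw [← hf _ h1N _ (N.mul_mem (N.inv_mem h1N) hx)]
    congr 1; group
  rw [h2]
  refine (abs_add_le _ _).trans ?_
  have hl' : (l.length : ℤ) ≤ r := by exact_mod_cast hl
  push_cast
  have hA := abs_nonneg (f (rep (1 : G)))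
  have hB := abs_nonneg (f (rep (1 : G))⁻¹)
  have hr : (0 : ℤ) ≤ r := by positivity
  have hC0 : (0 : ℤ) ≤ C := by positivity
  nlinarith [mul_nonneg hA hr, mul_nonneg hB hr, mul_le_mul_of_nonneg_left hl' hC0]

/-- If `π` is additive on a finite index normal subgroup `N` with values in `ℤⁿ` and injective
on a subgroup `H ≤ N`, then every coset of `H` grows at most like `rⁿ`. -/
theorem exists_subsetGrowth_coset_le {G : Type*} [Group G] {S : Set G} (hSfin : S.Finite)
    (hS : Subgroup.closure S = ⊤) (N : Subgroup G) [N.Normal] [N.FiniteIndex] {H : Subgroup G}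
    (hHN : H ≤ N) {n : ℕ} (π : G → Fin n → ℤ) (hπ : ∀ a ∈ N, ∀ b ∈ N, π (a * b) = π a + π b)
    (hinj : Set.InjOn π H) (h : G) :
    ∃ C : ℝ, 0 < C ∧ ∀ r : ℕ, 1 ≤ r →
      (subsetGrowth {x | x * h⁻¹ ∈ H} S r : ℝ) ≤ C * (r : ℝ) ^ n := by
  choose K hK using fun i => exists_abs_le_of_mem_ball hSfin N (fun x => π x i)
    fun a ha b hb => congrFun (hπ a ha b hb) i
  obtain ⟨l, hl⟩ := exists_mem_ball hS h⁻¹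
  set D := ∑ i, K i
  have hKD (i : Fin n) : K i ≤ D :=
    Finset.single_le_sum (fun _ _ => Nat.zero_le _) (Finset.mem_univ i)
  refine ⟨(2 * (D * (l + 2)) + 1) ^ n, by positivity, fun r hr => ?_⟩
  let B : ℕ := D * (r + l + 1)
  let box : Finset (Fin n → ℤ) := Fintype.piFinset fun _ => Finset.Icc (-(B : ℤ)) B
  have hle : subsetGrowth {x | x * h⁻¹ ∈ H} S r ≤ box.card := by
    rw [← Set.ncard_coe_finset]
    refine Set.ncard_le_ncard_of_injOn (fun x => π (x * h⁻¹)) ?_ ?_ box.finite_toSet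
    · rintro x ⟨hxH, hxr⟩
      simp only [box, Finset.mem_coe, Fintype.mem_piFinset, Finset.mem_Icc, ← abs_le]
      intro i
      refine (hK i (r + l) _ (hHN hxH) (ball_mul_mem hxr hl)).trans ?_
      have := Nat.mul_le_mul_right (r + l + 1) (hKD i)
      exact_mod_cast this
    · rintro x ⟨hxH, -⟩ y ⟨hyH, -⟩ hxy
      exact mul_right_cancel (hinj hxH hyH hxy)
  have hbox : box.card = (2 * B + 1) ^ n := by
    simp only [box, Fintype.card_piFinset, Int.card_Icc, Finset.prod_const, Finset.card_univ,
      Fintype.card_fin]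
    congr 1; omega
  have hB : 2 * B + 1 ≤ (2 * (D * (l + 2)) + 1) * r := by
    have h1 : r + l + 1 ≤ (l + 2) * r := by nlinarith
    have h2 := Nat.mul_le_mul_left D h1
    simp only [B]
    nlinarith
  have := hle.trans (hbox.le.trans (Nat.pow_le_pow_left hB n))
  rw [mul_pow] at this
  exact_mod_cast this

/-! ### Ranks of subgroups of free abelian groups -/

/-- A submodule of a finitely generated free abelian group is a copy of some `ℤⁿ` which is
mapped injectively by some projection of the ambient group to `ℤⁿ`. -/
theorem exists_embedding_and_projection {A : Type*} [AddCommGroup A] [Module.Finite ℤ A]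
    [Module.Free ℤ A] (P : Submodule ℤ A) :
    ∃ (n : ℕ) (F : (Fin n → ℤ) →ₗ[ℤ] A) (π : A →ₗ[ℤ] (Fin n → ℤ)),
      Function.Injective F ∧ (∀ v, F v ∈ P) ∧ Set.InjOn π P := by
  obtain ⟨n, snf⟩ := P.smithNormalForm (Module.Free.chooseBasis ℤ A)
  refine ⟨n, P.subtype ∘ₗ snf.bN.equivFun.symm.toLinearMap,
    LinearMap.pi fun i => snf.bM.coord (snf.f i), ?_, fun v => ?_, ?_⟩
  · exact P.subtype_injective.comp snf.bN.equivFun.symm.injective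
  · exact (snf.bN.equivFun.symm v).2
  · intro x hx y hy hxy
    refine snf.bM.ext_elem fun i => ?_
    by_cases hi : i ∈ Set.range snf.f
    · obtain ⟨j, rfl⟩ := hi
      exact congrFun hxy j
    · rw [snf.repr_eq_zero_of_notMem_range ⟨x, hx⟩ hi, snf.repr_eq_zero_of_notMem_range ⟨y, hy⟩ hi]

theorem grpRank_eq {G : Type*} [Group G] {N H : Subgroup G} (hHN : H ≤ N) {n : ℕ}
    (F : Multiplicative (Fin n → ℤ) →* G) (hF : Function.Injective F) (hFH : ∀ v, F v ∈ H)
    (π : G → Fin n → ℤ) (hπ : ∀ a ∈ N, ∀ b ∈ N, π (a * b) = π a + π b)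
    (hinj : Set.InjOn π H) : grpRank H = n := by
  refine IsGreatest.csSup_eq ⟨⟨F, hF, hFH⟩, ?_⟩
  rintro m ⟨f, hf, hfH⟩
  let p : (Fin m → ℤ) →+ (Fin n → ℤ) := AddMonoidHom.mk' (fun v => π (f (Multiplicative.ofAdd v)))
    fun v w => by rw [ofAdd_add, map_mul, hπ _ (hHN (hfH _)) _ (hHN (hfH _))]
  refine le_of_fin_injective ℤ p.toIntLinearMap fun v w hvw => ?_
  exact Multiplicative.ofAdd.injective (hf (hinj (hfH _) (hfH _) hvw))

/-- A subgroup `H` of a finitely generated torsion-free abelian subgroup `N` contains an embedded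
`ℤⁿ`, `n = grpRank H`, and is mapped injectively by a homomorphism from `N` to `ℤⁿ`. -/
theorem exists_embedding_and_projection_grpRank {G : Type*} [Group G] (N : Subgroup G)
    [Group.FG N] (hNab : ∀ x ∈ N, ∀ y ∈ N, x * y = y * x)
    (hNtf : ∀ x ∈ N, ∀ k : ℕ, 0 < k → x ^ k = 1 → x = 1) {H : Subgroup G} (hHN : H ≤ N) :
    ∃ (F : Multiplicative (Fin (grpRank H) → ℤ) →* G) (π : G → Fin (grpRank H) → ℤ),
      Function.Injective F ∧ (∀ v, F v ∈ H) ∧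
      (∀ a ∈ N, ∀ b ∈ N, π (a * b) = π a + π b) ∧ Set.InjOn π H := by
  classical
  let _ : CommGroup N :=
    { (inferInstance : Group N) with
      mul_comm := fun x y => Subtype.ext (hNab x x.2 y y.2) }
  have : Module.Finite ℤ (Additive N) := Module.Finite.iff_addGroup_fg.2 inferInstance
  have : IsMulTorsionFree N := by
    refine isMulTorsionFree_iff_not_isOfFinOrder.2 fun x hx hfin => hx ?_
    obtain ⟨k, hk, hxk⟩ := isOfFinOrder_iff_pow_eq_one.1 hfin
    exact Subtype.ext (hNtf x x.2 k hk (by simpa using congrArg Subtype.val hxk))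
  let P : Submodule ℤ (Additive N) :=
    AddSubgroup.toIntSubmodule (Subgroup.toAddSubgroup (H.subgroupOf N))
  obtain ⟨n, F, π, hF, hFP, hπ⟩ := exists_embedding_and_projection P
  let F' : Multiplicative (Fin n → ℤ) →* G :=
    N.subtype.comp (AddMonoidHom.toMultiplicativeLeft F.toAddMonoidHom)
  let π' : G → Fin n → ℤ := fun x => if hx : x ∈ N then π (Additive.ofMul ⟨x, hx⟩) else 0
  have hπ' (x : G) (hx : x ∈ N) : π' x = π (Additive.ofMul ⟨x, hx⟩) := dif_pos hx
  have hF' : Function.Injective F' := N.subtype_injective.comp hF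
  have hFH (v) : F' v ∈ H := hFP v
  have hadd : ∀ a ∈ N, ∀ b ∈ N, π' (a * b) = π' a + π' b := by
    intro a ha b hb
    rw [hπ' _ ha, hπ' _ hb, hπ' _ (N.mul_mem ha hb), ← map_add]
    rfl
  have hinj : Set.InjOn π' H := by
    intro x hx y hy hxy
    rw [hπ' _ (hHN hx), hπ' _ (hHN hy)] at hxy
    exact congrArg Subtype.val (Additive.ofMul.injective (hπ hx hy hxy))
  obtain rfl := grpRank_eq hHN F' hF' hFH π' hadd hinj
  exact ⟨F', π', hF', hFH, hadd, hinj⟩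

/-! ### Twisted conjugacy classes as finite unions of cosets -/

theorem twistImage_le {G : Type*} [Group G] (φ : G →* G) (N : Subgroup G) [N.Normal]
    (hφN : ∀ x ∈ N, φ x ∈ N) (g : G) : twistImage φ N g ≤ N := by
  refine (Subgroup.closure_le N).2 ?_
  rintro _ ⟨x, hx, rfl⟩
  exact N.mul_mem hx (N.inv_mem (Subgroup.Normal.conj_mem ‹_› _ (hφN x hx) g))

theorem exists_of_mem_twistImage {G : Type*} [Group G] (φ : G →* G) (N : Subgroup G) [N.Normal]
    (hNab : ∀ x ∈ N, ∀ y ∈ N, x * y = y * x) (hφN : ∀ x ∈ N, φ x ∈ N) {g y : G}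
    (hy : y ∈ twistImage φ N g) : ∃ x ∈ N, y = x * (g * φ x * g⁻¹)⁻¹ := by
  have hc (x : G) (hx : x ∈ N) : g * φ x * g⁻¹ ∈ N :=
    Subgroup.Normal.conj_mem ‹_› _ (hφN x hx) g
  induction hy using Subgroup.closure_induction with
  | mem y hy => exact hy
  | one => exact ⟨1, N.one_mem, by simp⟩
  | mul a b _ _ iha ihb =>
    obtain ⟨x, hx, rfl⟩ := iha
    obtain ⟨y, hy, rfl⟩ := ihb
    refine ⟨x * y, N.mul_mem hx hy, ?_⟩
    have e : g * φ (x * y) * g⁻¹ = (g * φ x * g⁻¹) * (g * φ y * g⁻¹) := by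
      rw [map_mul]; group
    have hcomm := hNab _ (N.inv_mem (hc x hx)) _
      (N.mul_mem hy (N.inv_mem (hc y hy)))
    rw [e, mul_assoc x, hcomm, mul_inv_rev (g * φ x * g⁻¹) (g * φ y * g⁻¹)]
    simp only [mul_assoc]
  | inv a _ iha =>
    obtain ⟨x, hx, rfl⟩ := iha
    refine ⟨x⁻¹, N.inv_mem hx, ?_⟩
    have e : (g * φ x⁻¹ * g⁻¹)⁻¹ = g * φ x * g⁻¹ := by
      rw [map_inv]; group
    rw [e, mul_inv_rev, inv_inv]
    exact hNab _ (hc x hx) _ (N.inv_mem hx)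

theorem twistImage_eq_of_inv_mul_mem {G : Type*} [Group G] (φ : G →* G) (N : Subgroup G)
    (hNab : ∀ x ∈ N, ∀ y ∈ N, x * y = y * x) (hφN : ∀ x ∈ N, φ x ∈ N) {g h : G}
    (hgh : g⁻¹ * h ∈ N) : twistImage φ N g = twistImage φ N h := by
  have e (x : G) (hx : x ∈ N) : h * φ x * h⁻¹ = g * φ x * g⁻¹ := by
    have hcomm := hNab _ hgh _ (hφN x hx)
    calc h * φ x * h⁻¹ = g * (g⁻¹ * h * φ x) * h⁻¹ := by group
      _ = g * φ x * g⁻¹ := by rw [hcomm]; group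
  unfold twistImage
  congr 1
  ext y
  exact exists_congr fun x => and_congr_right fun hx => by rw [e x hx]

theorem mul_mem_twistedConjClass {G : Type*} [Group G] (φ : G →* G) (N : Subgroup G) [N.Normal]
    (hNab : ∀ x ∈ N, ∀ y ∈ N, x * y = y * x) (hφN : ∀ x ∈ N, φ x ∈ N) {g₀ h y : G}
    (hh : TwistedConj φ h g₀) (hy : y ∈ twistImage φ N h) : y * h ∈ twistedConjClass φ g₀ := by
  obtain ⟨x, -, rfl⟩ := exists_of_mem_twistImage φ N hNab hφN hy
  obtain ⟨z, rfl⟩ := hh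
  refine ⟨x * z, ?_⟩
  rw [map_mul]
  group

/-- A twisted conjugacy class is covered by the cosets of the subgroups `twistImage φ N h`,
with `h` running through the twisted conjugates of `g₀` by coset representatives of `N`. -/
theorem twistedConjClass_subset {G : Type*} [Group G] (φ : G →* G) (N : Subgroup G) [N.Normal]
    (g₀ : G) : twistedConjClass φ g₀ ⊆ ⋃ q : G ⧸ N,
      {x | x * (q.out * g₀ * (φ q.out)⁻¹)⁻¹ ∈ twistImage φ N (q.out * g₀ * (φ q.out)⁻¹)} := by
  rintro _ ⟨z, rfl⟩
  refine Set.mem_iUnion.2 ⟨(z : G ⧸ N), ?_⟩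
  set t := (z : G ⧸ N).out
  have htz : t⁻¹ * z ∈ N := QuotientGroup.eq.1 (Quotient.out_eq' _)
  have hzt : z * t⁻¹ ∈ N := Subgroup.Normal.mem_comm ‹_› htz
  refine Subgroup.subset_closure ⟨z * t⁻¹, hzt, ?_⟩
  simp only [map_mul, map_inv]
  group

/-- **Twisted conjugacy class growth of finitely generated virtually abelian groups.** The class
`[g₀]_φ` grows polynomially of degree `max{rank(Id_N − (τ_g ∘ φ)|_N) : gN ∈ G/N` such that
`[g₀]_φ ∩ p⁻¹(gN) ≠ ∅}`. -/
theorem twisted_conjugacy_class_growth_virtually_abelian {G : Type*} [Group G]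
    (S : Set G) (hSfin : S.Finite) (hSgen : Subgroup.closure S = ⊤)
    (N : Subgroup G) (hNnorm : N.Normal) (hNfin : N.FiniteIndex)
    (hNab : ∀ x ∈ N, ∀ y ∈ N, x * y = y * x)
    (hNtf : ∀ x ∈ N, ∀ k : ℕ, 0 < k → x ^ k = 1 → x = 1)
    (φ : G →* G) (hφN : ∀ x ∈ N, φ x ∈ N) (g₀ : G) :
    IsThetaNat (subsetGrowth (twistedConjClass φ g₀) S)
      (fun r => r ^ sSup {m : ℕ | ∃ g : G,
        (∃ h, TwistedConj φ h g₀ ∧ g⁻¹ * h ∈ N) ∧ m = grpRank (twistImage φ N g)}) := by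
  have : Finite (G ⧸ N) := inferInstance
  have : Group.FG G := Group.fg_iff.2 ⟨S, hSgen, hSfin⟩
  have hle (g : G) := twistImage_le φ N hφN g
  have hrank (g : G) := exists_embedding_and_projection_grpRank N hNab hNtf (hle g)
  set M : Set ℕ := {m : ℕ | ∃ g : G,
    (∃ h, TwistedConj φ h g₀ ∧ g⁻¹ * h ∈ N) ∧ m = grpRank (twistImage φ N g)}
  have hMbdd : BddAbove M := by
    refine ((Set.finite_range fun q : G ⧸ N => grpRank (twistImage φ N q.out)).subset ?_).bddAbove
    rintro _ ⟨g, -, rfl⟩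
    refine ⟨(g : G ⧸ N), ?_⟩
    dsimp only
    rw [twistImage_eq_of_inv_mul_mem φ N hNab hφN (QuotientGroup.eq.1 (Quotient.out_eq' _))]
  have hMmem (h : G) (hh : TwistedConj φ h g₀) : grpRank (twistImage φ N h) ∈ M :=
    ⟨h, ⟨h, hh, by simp⟩, rfl⟩
  have hMne : M.Nonempty := ⟨_, hMmem g₀ ⟨1, by simp⟩⟩
  obtain ⟨g, ⟨h, hh, hgh⟩, hk⟩ := Nat.sSup_mem hMne hMbdd
  rw [twistImage_eq_of_inv_mul_mem φ N hNab hφN hgh] at hk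
  set k := sSup M
  obtain ⟨F, -, hF, hFH, -, -⟩ := hrank h
  obtain ⟨c, hc, n₀, hlow⟩ := exists_mul_pow_le_subsetGrowth hSfin hSgen F hF
    (U := twistedConjClass φ g₀) (h := h)
    fun v => mul_mem_twistedConjClass φ N hNab hφN hh (hFH v)
  rw [← hk] at hlow
  let t : G ⧸ N → G := fun q => q.out * g₀ * (φ q.out)⁻¹
  have hup (q : G ⧸ N) : ∃ C : ℝ, 0 < C ∧ ∀ r : ℕ, 1 ≤ r →
      (subsetGrowth {x | x * (t q)⁻¹ ∈ twistImage φ N (t q)} S r : ℝ) ≤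
        C * (r : ℝ) ^ grpRank (twistImage φ N (t q)) := by
    obtain ⟨-, π, -, -, hπ, hinj⟩ := hrank (t q)
    exact exists_subsetGrowth_coset_le hSfin hSgen N (hle _) π hπ hinj _
  choose C hC0 hC using hup
  have := Fintype.ofFinite (G ⧸ N)
  refine ⟨c, ∑ q, C q, hc, Finset.sum_pos (fun q _ => hC0 q) Finset.univ_nonempty,
    max n₀ 1, by simp, fun r hr => ⟨?_, ?_⟩⟩
  · simpa using hlow r (le_of_max_le_left hr)
  have hr1 : 1 ≤ r := le_of_max_le_right hr
  have hfin (q : G ⧸ N) : ({x | x * (t q)⁻¹ ∈ twistImage φ N (t q)} ∩ ball S r).Finite :=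
    (finite_ball hSfin r).inter_of_right _
  have hcover : subsetGrowth (twistedConjClass φ g₀) S r ≤
      ∑ q, subsetGrowth {x | x * (t q)⁻¹ ∈ twistImage φ N (t q)} S r := by
    refine (Set.ncard_le_ncard ?_ (Set.finite_iUnion hfin)).trans (Set.ncard_iUnion_le_of_fintype _)
    rw [← Set.iUnion_inter]
    exact Set.inter_subset_inter_left _ (twistedConjClass_subset φ N g₀)
  calc (subsetGrowth (twistedConjClass φ g₀) S r : ℝ)
      ≤ ∑ q, (subsetGrowth {x | x * (t q)⁻¹ ∈ twistImage φ N (t q)} S r : ℝ) := by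
        exact_mod_cast hcover
    _ ≤ ∑ q, C q * (r : ℝ) ^ k := by
        refine Finset.sum_le_sum fun q _ => (hC q r hr1).trans ?_
        refine mul_le_mul_of_nonneg_left ?_ (hC0 q).le
        exact pow_le_pow_right₀ (by exact_mod_cast hr1) (le_csSup hMbdd (hMmem _ ⟨q.out, rfl⟩))
    _ = (∑ q, C q) * ((r ^ k : ℕ) : ℝ) := by rw [← Finset.sum_mul]; push_cast; rfl
end

section
/- Let G be a finitely generated virtually abelian group containing Z^n as a normal subgroup of finite index, and let φ ∈ End(G) satisfy φ(Z^n) ⊆ Z^n. For each k ∈ ℕ_{>0} let φ̄_k denote the endomorphism induced by φ on the finite quotient G/(kZ)^n, and define the twisted conjugacy quotient growth function f_Q(k) := R(φ̄_k), the number of φ̄_k-twisted conjugacy classes of G/(kZ)^n. Then f_Q(k) = Θ(k^{n − m}) as k → ∞, where m = min over cosets gZ^n ∈ G/Z^n of rank(Id_{Z^n} − (τ_g ∘ φ)|_{Z^n}). -/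
open Filter Topology
open scoped Pointwise NNReal

/-- The subgroup `kN` of `G` (corresponding to `(kℤ)ⁿ` when `N ≅ ℤⁿ`): the subgroup
generated by the `k`-th powers of elements of `N`. -/
def powSubgroup {G : Type*} [Group G] (N : Subgroup G) (k : ℕ) : Subgroup G :=
  Subgroup.closure {y | ∃ x ∈ N, y = x ^ k}

/-- The twisted conjugacy quotient growth function: `f_Q(k)` is the Reidemeister number of the
endomorphism induced by `φ` on the quotient `G/kN`, counted as the number of equivalence classes
on `G` of the lifted twisted conjugacy relation. -/
noncomputable def fQ {G : Type*} [Group G] (φ : G →* G) (N : Subgroup G) (k : ℕ) : ℕ :=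
  Nat.card {C : Set G | ∃ g : G,
    C = {x | ∃ z : G, (z * g * (φ z)⁻¹)⁻¹ * x ∈ powSubgroup N k}}

theorem AddSubgroup.index_range_nsmul_of_free {A : Type*} [AddCommGroup A] [Module.Free ℤ A]
    [Module.Finite ℤ A] (k : ℕ) :
    (nsmulAddMonoidHom k : A →+ A).range.index = k ^ Module.finrank ℤ A := by
  let b := Module.finBasis ℤ A
  let f : A →+ (Fin (Module.finrank ℤ A) → ZMod k) :=
    (((Int.castAddHom (ZMod k)).compLeft _)).comp b.equivFun.toLinearMap.toAddMonoidHom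
  have hf (a : A) (i) : f a i = (b.equivFun a i : ZMod k) := rfl
  have hker : (nsmulAddMonoidHom k : A →+ A).range = f.ker := by
    ext a
    simp only [AddMonoidHom.mem_range, AddMonoidHom.mem_ker, nsmulAddMonoidHom_apply,
      funext_iff, hf, Pi.zero_apply, CharP.intCast_eq_zero_iff (ZMod k) k]
    constructor
    · rintro ⟨c, rfl⟩ i
      simp
    · intro h
      choose c hc using h
      refine ⟨b.equivFun.symm c, b.equivFun.injective ?_⟩
      ext i
      simp [hc i, -Module.Basis.equivFun_apply]
  have hsurj : Function.Surjective f := by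
    intro v
    choose c hc using fun i => ZMod.intCast_surjective (v i)
    exact ⟨b.equivFun.symm c, funext fun i => by rw [hf, LinearEquiv.apply_symm_apply, hc]⟩
  rw [hker, AddSubgroup.index_ker, AddMonoidHom.range_eq_top_of_surjective f hsurj]
  simp [Nat.card_fun]

theorem AddSubgroup.relIndex_range_nsmul_le {A : Type*} [AddCommGroup A] [Module.Free ℤ A]
    [Module.Finite ℤ A] (P : Submodule ℤ A) {k : ℕ} (hk : 0 < k) :
    (nsmulAddMonoidHom k : A →+ A).range.relIndex P.toAddSubgroup ≤ k ^ Module.finrank ℤ P := by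
  have h := AddSubgroup.index_range_nsmul_of_free (A := P) k
  rw [← h]
  refine Nat.le_of_dvd (by rw [h]; positivity) (AddSubgroup.index_dvd_of_le ?_)
  rintro _ ⟨c, rfl⟩
  exact ⟨(c : A), rfl⟩

theorem Submodule.exists_disjoint_finite_quotient_sup {A : Type*} [AddCommGroup A]
    [Module.Free ℤ A] [Module.Finite ℤ A] (M : Submodule ℤ A) :
    ∃ P : Submodule ℤ A, Module.finrank ℤ P + Module.finrank ℤ M = Module.finrank ℤ A ∧
      Finite (A ⧸ M ⊔ P) := by
  obtain ⟨v, hv⟩ := exists_linearIndependent_of_le_finrank (R := ℤ) (M := A ⧸ M) le_rfl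
  choose w hw using fun i => M.mkQ_surjective (v i)
  have hv' : LinearIndependent ℤ (M.mkQ ∘ w) := by convert hv; exact funext hw
  have hdisj := Submodule.range_ker_disjoint hv'
  have hw' : LinearIndependent ℤ w := LinearIndependent.of_comp _ hv'
  have hrank : Module.finrank ℤ (Submodule.span ℤ (Set.range w)) + Module.finrank ℤ M =
      Module.finrank ℤ A := by
    rw [finrank_span_eq_card hw', Fintype.card_fin, Submodule.finrank_quotient_add_finrank]
  refine ⟨_, hrank, Submodule.finiteQuotientOfFreeOfRankEq _ ?_⟩
  have h := Submodule.rank_sup_add_rank_inf_eq M (Submodule.span ℤ (Set.range w))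
  rw [Submodule.ker_mkQ] at hdisj
  rw [inf_comm, hdisj.eq_bot, rank_bot, add_zero, ← Module.finrank_eq_rank,
    ← Module.finrank_eq_rank, ← Module.finrank_eq_rank] at h
  rw [← hrank, add_comm]
  exact_mod_cast h

theorem AddSubgroup.le_index_sup_range_nsmul {A : Type*} [AddCommGroup A]
    [Module.Free ℤ A] [Module.Finite ℤ A] (M : Submodule ℤ A) {k : ℕ} (hk : 0 < k) :
    k ^ (Module.finrank ℤ A - Module.finrank ℤ M) ≤
      (M.toAddSubgroup ⊔ (nsmulAddMonoidHom k : A →+ A).range).index := by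
  set K := (nsmulAddMonoidHom k : A →+ A).range
  have h := AddSubgroup.relIndex_mul_index (H := K) (K := M.toAddSubgroup ⊔ K) le_sup_right
  rw [AddSubgroup.relIndex_sup_right, AddSubgroup.index_range_nsmul_of_free] at h
  have hle := Nat.mul_le_mul_right (M.toAddSubgroup ⊔ K).index
    (AddSubgroup.relIndex_range_nsmul_le M hk)
  rw [h, ← Nat.add_sub_cancel' (Submodule.finrank_le M), pow_add] at hle
  exact Nat.le_of_mul_le_mul_left hle (by positivity)

theorem AddSubgroup.exists_index_sup_range_nsmul_le {A : Type*} [AddCommGroup A]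
    [Module.Free ℤ A] [Module.Finite ℤ A] (M : Submodule ℤ A) :
    ∃ C : ℕ, ∀ k : ℕ, 0 < k → (M.toAddSubgroup ⊔ (nsmulAddMonoidHom k : A →+ A).range).index ≤
      C * k ^ (Module.finrank ℤ A - Module.finrank ℤ M) := by
  obtain ⟨P, hP, hfin⟩ := M.exists_disjoint_finite_quotient_sup
  refine ⟨(M ⊔ P).toAddSubgroup.index, fun k hk => ?_⟩
  set K := (nsmulAddMonoidHom k : A →+ A).range
  have hK : K.index ≠ 0 := by
    rw [AddSubgroup.index_range_nsmul_of_free]; positivity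
  have hrel : K.relIndex P.toAddSubgroup ≠ 0 := fun h =>
    hK (AddSubgroup.index_eq_zero_of_relIndex_eq_zero h)
  have h := AddSubgroup.relIndex_mul_index (H := M.toAddSubgroup ⊔ K)
    (K := P.toAddSubgroup ⊔ (M.toAddSubgroup ⊔ K)) le_sup_right
  rw [AddSubgroup.relIndex_sup_right] at h
  rw [← h, mul_comm, ← hP, Nat.add_sub_cancel]
  refine Nat.mul_le_mul ?_ ((AddSubgroup.relIndex_le_of_le_left le_sup_right hrel).trans
    (AddSubgroup.relIndex_range_nsmul_le P hk))
  have : Finite (A ⧸ (M ⊔ P).toAddSubgroup) := hfin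
  refine Nat.le_of_dvd (Nat.pos_of_ne_zero AddSubgroup.index_ne_zero_of_finite)
    (AddSubgroup.index_dvd_of_le ?_)
  rw [Submodule.sup_toAddSubgroup]
  exact sup_le (le_sup_left.trans le_sup_right) le_sup_left

open scoped IsMulCommutative

theorem Subgroup.index_sup_range_pow_eq {H : Type*} [CommGroup H] (K : Subgroup H) (k : ℕ) :
    (K ⊔ (powMonoidHom k : H →* H).range).index =
      ((AddSubgroup.toIntSubmodule K.toAddSubgroup).toAddSubgroup ⊔
        (nsmulAddMonoidHom k : Additive H →+ Additive H).range).index := by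
  rw [← Subgroup.index_toAddSubgroup, OrderIso.map_sup]
  rfl

/-- For a subgroup of a finitely generated free abelian subgroup, `grpRank` is the `ℤ`-rank. -/
theorem grpRank_map_subtype {G : Type*} [Group G] (N : Subgroup G) [IsMulCommutative N]
    [Module.Free ℤ (Additive N)] [Module.Finite ℤ (Additive N)] (K : Subgroup N) :
    grpRank (K.map N.subtype) =
      Module.finrank ℤ (AddSubgroup.toIntSubmodule K.toAddSubgroup) := by
  set M := AddSubgroup.toIntSubmodule K.toAddSubgroup
  refine IsGreatest.csSup_eq ⟨?_, ?_⟩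
  · let j := M.subtype ∘ₗ (Module.finBasis ℤ M).equivFun.symm.toLinearMap
    have hj : Function.Injective j :=
      M.subtype_injective.comp (Module.finBasis ℤ M).equivFun.symm.injective
    refine ⟨N.subtype.comp (AddMonoidHom.toMultiplicativeLeft j.toAddMonoidHom),
      fun v w h => hj (Subtype.val_injective h), fun v => ?_⟩
    exact ⟨_, ((Module.finBasis ℤ M).equivFun.symm v).2, rfl⟩
  · rintro s ⟨f, hf, hfK⟩
    let f' : (Fin s → ℤ) →ₗ[ℤ] Additive N := (MonoidHom.toAdditiveRight
      (f.codRestrict N fun v => Subgroup.map_subtype_le K (hfK v))).toIntLinearMap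
    have hf' : Function.Injective f' := fun v w h => hf (congrArg Subtype.val h)
    have hle : LinearMap.range f' ≤ M := by
      rintro _ ⟨v, rfl⟩
      obtain ⟨x, hx, hxv⟩ := hfK v
      have : f' v = x := Subtype.ext hxv.symm
      rw [this]
      exact hx
    calc s = Module.finrank ℤ (LinearMap.range f') := by
          rw [LinearMap.finrank_range_of_inj hf', Module.finrank_fin_fun]
      _ ≤ Module.finrank ℤ M := Submodule.finrank_mono hle

section TwistedConjugacy

variable {G : Type*} [Group G] {φ : G →* G} {N : Subgroup G}

theorem powSubgroup_eq_map [IsMulCommutative N] (k : ℕ) :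
    powSubgroup N k = (powMonoidHom k : N →* N).range.map N.subtype := by
  rw [← Subgroup.closure_eq ((powMonoidHom k : N →* N).range.map N.subtype), powSubgroup]
  congr 1
  ext y
  constructor
  · rintro ⟨x, hx, rfl⟩
    exact ⟨_, ⟨⟨x, hx⟩, rfl⟩, rfl⟩
  · rintro ⟨_, ⟨x, rfl⟩, rfl⟩
    exact ⟨x, x.2, rfl⟩

theorem powSubgroup_normal [hN : N.Normal] (k : ℕ) : (powSubgroup N k).Normal := by
  refine ⟨fun x hx g => ?_⟩
  have hle : powSubgroup N k ≤ (powSubgroup N k).comap (MulAut.conj g).toMonoidHom := by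
    refine (Subgroup.closure_le _).2 ?_
    rintro _ ⟨x, hx, rfl⟩
    exact Subgroup.subset_closure ⟨g * x * g⁻¹, hN.conj_mem x hx g, by simp⟩
  exact hle hx

/-- The endomorphism `Id - τ_g ∘ φ` of an abelian normal `φ`-invariant subgroup. -/
def twistHom [N.Normal] [IsMulCommutative N] (hφN : ∀ x ∈ N, φ x ∈ N) (g : G) : N →* N :=
  MonoidHom.id N / (MulAut.conjNormal g).toMonoidHom.comp
    (φ.restrict hφN)

theorem coe_twistHom [N.Normal] [IsMulCommutative N] (hφN : ∀ x ∈ N, φ x ∈ N) (g : G) (x : N) :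
    (twistHom hφN g x : G) = x * (g * φ x * g⁻¹)⁻¹ := by
  rw [twistHom, MonoidHom.div_apply, div_eq_mul_inv]
  rfl

theorem twistImage_eq_map [N.Normal] [IsMulCommutative N] (hφN : ∀ x ∈ N, φ x ∈ N) (g : G) :
    twistImage φ N g = (twistHom hφN g).range.map N.subtype := by
  rw [← Subgroup.closure_eq ((twistHom hφN g).range.map N.subtype), twistImage]
  congr 1
  ext y
  constructor
  · rintro ⟨x, hx, rfl⟩
    exact ⟨_, ⟨⟨x, hx⟩, rfl⟩, coe_twistHom hφN g ⟨x, hx⟩⟩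
  · rintro ⟨_, ⟨x, rfl⟩, rfl⟩
    exact ⟨x, x.2, coe_twistHom hφN g x⟩

/-- The `φ`-twisted conjugacy class of `x` modulo `K`. -/
def twistedClass (φ : G →* G) (K : Subgroup G) (x : G) : Set G :=
  {y | ∃ z : G, (z * x * (φ z)⁻¹)⁻¹ * y ∈ K}

theorem mem_twistedClass_self {K : Subgroup G} (x : G) : x ∈ twistedClass φ K x :=
  ⟨1, by simp⟩

theorem twistedClass_subset {K : Subgroup G} [hK : K.Normal] {x y : G}
    (h : y ∈ twistedClass φ K x) : twistedClass φ K y ⊆ twistedClass φ K x := by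
  obtain ⟨z, hz⟩ := h
  rintro t ⟨w, hw⟩
  refine ⟨w * z, ?_⟩
  convert K.mul_mem (hK.conj_mem _ hz (φ w)) hw using 1
  rw [map_mul]
  group

theorem twistedClass_symm {K : Subgroup G} [hK : K.Normal] {x y : G}
    (h : y ∈ twistedClass φ K x) : x ∈ twistedClass φ K y := by
  obtain ⟨z, hz⟩ := h
  refine ⟨z⁻¹, ?_⟩
  convert hK.conj_mem _ (K.inv_mem hz) (φ z)⁻¹ using 1
  rw [map_inv]
  group

theorem twistedClass_eq_iff {K : Subgroup G} [K.Normal] {x y : G} :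
    twistedClass φ K x = twistedClass φ K y ↔ y ∈ twistedClass φ K x :=
  ⟨fun h => h ▸ mem_twistedClass_self y, fun h =>
    (twistedClass_subset (twistedClass_symm h)).antisymm (twistedClass_subset h)⟩

/-- Inside a coset `N g`, twisted conjugacy by elements of `N` modulo `kN` is congruence modulo
the subgroup generated by the image of `twistHom` and the `k`-th powers. -/
theorem inv_mul_mem_sup_iff [N.Normal] [IsMulCommutative N] (hφN : ∀ x ∈ N, φ x ∈ N) (g : G)
    (k : ℕ) (a b : N) :
    a⁻¹ * b ∈ (twistHom hφN g).range ⊔ (powMonoidHom k : N →* N).range ↔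
      ∃ c : N, (c * (a * g) * (φ c)⁻¹)⁻¹ * (b * g) ∈ powSubgroup N k := by
  have hK := powSubgroup_normal (N := N) k
  have key (c : N) : (c * (a * g) * (φ c)⁻¹)⁻¹ * (b * g) ∈ powSubgroup N k ↔
      (a * twistHom hφN g c)⁻¹ * b ∈ (powMonoidHom k : N →* N).range := by
    have h1 : (c * (a * g) * (φ c)⁻¹ : G) = ((a * twistHom hφN g c : N) : G) * g := by
      have hca : (c * a : G) = a * c := congrArg Subtype.val (mul_comm c a)
      rw [← mul_assoc, hca, Subgroup.coe_mul, coe_twistHom]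
      group
    have h2 : (c * (a * g) * (φ c)⁻¹)⁻¹ * (b * g) =
        g⁻¹ * (((a * twistHom hφN g c)⁻¹ * b : N) : G) * g⁻¹⁻¹ := by
      simp only [h1, Subgroup.coe_mul, Subgroup.coe_inv]
      group
    rw [h2, mul_assoc, hK.mem_comm_iff, mul_assoc, inv_mul_cancel, mul_one, powSubgroup_eq_map]
    exact Subgroup.mem_map_iff_mem N.subtype_injective (x := (a * twistHom hφN g c)⁻¹ * b)
  simp_rw [key]
  rw [Subgroup.mem_sup]
  constructor
  · rintro ⟨_, ⟨c, rfl⟩, p, hp, h⟩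
    refine ⟨c, ?_⟩
    rwa [mul_inv_rev, mul_assoc, ← h, inv_mul_cancel_left]
  · rintro ⟨c, hc⟩
    exact ⟨_, ⟨c, rfl⟩, _, hc, by group⟩

theorem index_le_card_twistedClass_mul [N.Normal] [N.FiniteIndex] [IsMulCommutative N]
    (hφN : ∀ x ∈ N, φ x ∈ N) (g : G) (k : ℕ)
    (hfin : (Set.range (twistedClass φ (powSubgroup N k))).Finite) :
    ((twistHom hφN g).range ⊔ (powMonoidHom k : N →* N).range).index ≤
      Nat.card (Set.range (twistedClass φ (powSubgroup N k))) * N.index := by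
  have hK := powSubgroup_normal (N := N) k
  have := hfin.to_subtype
  set S := (twistHom hφN g).range ⊔ (powMonoidHom k : N →* N).range
  choose base hbase using fun C : Set.range (twistedClass φ (powSubgroup N k)) => C.2
  let cls (q : N ⧸ S) : Set.range (twistedClass φ (powSubgroup N k)) :=
    ⟨_, (q.out : G) * g, rfl⟩
  have hmem (q : N ⧸ S) :
      (q.out : G) * g ∈ twistedClass φ (powSubgroup N k) (base (cls q)) :=
    twistedClass_eq_iff.1 (hbase (cls q))
  choose z hz using hmem
  rw [Subgroup.index, Subgroup.index, ← Nat.card_prod]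
  refine Nat.card_le_card_of_injective (fun q => (cls q, (z q : G ⧸ N))) fun q r h => ?_
  obtain ⟨hcls, hcoset⟩ := Prod.ext_iff.1 h
  dsimp only at hcls hcoset
  have hc : z r * (z q)⁻¹ ∈ N :=
    (Subgroup.Normal.mem_comm_iff inferInstance).1 (QuotientGroup.eq.1 hcoset)
  rw [← q.out_eq', ← r.out_eq']
  refine QuotientGroup.eq.2 ((inv_mul_mem_sup_iff hφN g k _ _).2 ⟨⟨_, hc⟩, ?_⟩)
  have hq := hz q
  have hr := hz r
  rw [hcls] at hq
  convert (powSubgroup N k).mul_mem ((powSubgroup N k).inv_mem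
    (hK.conj_mem _ hq (φ (z r * (z q)⁻¹)))) hr using 1
  simp only [map_mul, map_inv]
  group

theorem finite_range_twistedClass_and_card_le [N.Normal] [N.FiniteIndex] [IsMulCommutative N]
    (hφN : ∀ x ∈ N, φ x ∈ N) (k : ℕ)
    (hS : ∀ g, ((twistHom hφN g).range ⊔ (powMonoidHom k : N →* N).range).index ≠ 0) :
    (Set.range (twistedClass φ (powSubgroup N k))).Finite ∧
      Nat.card (Set.range (twistedClass φ (powSubgroup N k))) ≤
        ∑ᶠ q : G ⧸ N,
          ((twistHom hφN q.out).range ⊔ (powMonoidHom k : N →* N).range).index := by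
  have hK := powSubgroup_normal (N := N) k
  let S (g : G) := (twistHom hφN g).range ⊔ (powMonoidHom k : N →* N).range
  have (g : G) : Finite (N ⧸ S g) := Nat.finite_of_card_ne_zero (hS g)
  let cls (p : Σ q : G ⧸ N, N ⧸ S q.out) : Set.range (twistedClass φ (powSubgroup N k)) :=
    ⟨_, (p.2.out : G) * p.1.out, rfl⟩
  have hcls : Function.Surjective cls := by
    rintro ⟨_, x, rfl⟩
    let q : G ⧸ N := x
    have ha : x * q.out⁻¹ ∈ N :=
      (Subgroup.Normal.mem_comm_iff inferInstance).1 (QuotientGroup.eq.1 q.out_eq')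
    let r : N ⧸ S q.out := (⟨_, ha⟩ : N)
    refine ⟨⟨q, r⟩, Subtype.ext (twistedClass_eq_iff.2 ?_)⟩
    obtain ⟨c, hc⟩ := (inv_mul_mem_sup_iff hφN q.out k r.out ⟨_, ha⟩).1
      (QuotientGroup.eq.1 r.out_eq')
    exact ⟨c, by simpa using hc⟩
  have := Fintype.ofFinite (G ⧸ N)
  refine ⟨Set.finite_coe_iff.1 (Finite.of_surjective cls hcls), ?_⟩
  rw [finsum_eq_sum_of_fintype]
  exact (Nat.card_le_card_of_surjective cls hcls).trans_eq Nat.card_sigma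

end TwistedConjugacy

theorem fQ_eq_card_range {G : Type*} [Group G] (φ : G →* G) (N : Subgroup G) (k : ℕ) :
    fQ φ N k = Nat.card (Set.range (twistedClass φ (powSubgroup N k))) := by
  rw [fQ]
  congr! 2
  ext C
  exact exists_congr fun _ => eq_comm

/-- **Twisted conjugacy quotient growth of finitely generated virtually abelian groups.** -/
theorem quotient_growth_virtually_abelian {G : Type*} [Group G] (hG : Group.FG G)
    (n : ℕ) (N : Subgroup G) (hNnorm : N.Normal) (hNfin : N.FiniteIndex)
    (e : N ≃* Multiplicative (Fin n → ℤ))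
    (φ : G →* G) (hφN : ∀ x ∈ N, φ x ∈ N) :
    IsThetaNat (fQ φ N) (fun k => k ^ (n - minTwistRank φ N)) := by
  have : IsMulCommutative N := ⟨⟨fun x y => e.injective (by simp [mul_comm])⟩⟩
  let eL : Additive N ≃ₗ[ℤ] (Fin n → ℤ) := (MulEquiv.toAdditiveLeft e).toIntLinearEquiv
  have : Module.Free ℤ (Additive N) := Module.Free.of_equiv eL.symm
  have : Module.Finite ℤ (Additive N) := Module.Finite.equiv eL.symm
  have hn : Module.finrank ℤ (Additive N) = n := by rw [eL.finrank_eq, Module.finrank_fin_fun]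
  let M (g : G) := AddSubgroup.toIntSubmodule (twistHom hφN g).range.toAddSubgroup
  have hM (g : G) : grpRank (twistImage φ N g) = Module.finrank ℤ (M g) := by
    rw [twistImage_eq_map hφN, grpRank_map_subtype]
  obtain ⟨g₀, hg₀⟩ : minTwistRank φ N ∈ {m : ℕ | ∃ g : G, m = grpRank (twistImage φ N g)} :=
    Nat.sInf_mem ⟨_, 1, rfl⟩
  have hmin (g : G) : minTwistRank φ N ≤ Module.finrank ℤ (M g) := Nat.sInf_le ⟨g, (hM g).symm⟩
  have hlow (g : G) (k : ℕ) (hk : 0 < k) : k ^ (n - Module.finrank ℤ (M g)) ≤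
      ((twistHom hφN g).range ⊔ (powMonoidHom k : N →* N).range).index := by
    rw [Subgroup.index_sup_range_pow_eq, ← hn]
    exact AddSubgroup.le_index_sup_range_nsmul (M g) hk
  have hup (g : G) : ∃ C : ℕ, ∀ k : ℕ, 0 < k →
      ((twistHom hφN g).range ⊔ (powMonoidHom k : N →* N).range).index ≤
        C * k ^ (n - minTwistRank φ N) := by
    obtain ⟨C, hC⟩ := AddSubgroup.exists_index_sup_range_nsmul_le (M g)
    refine ⟨C, fun k hk => ?_⟩
    rw [Subgroup.index_sup_range_pow_eq]
    refine (hC k hk).trans (Nat.mul_le_mul_left _ (Nat.pow_le_pow_right hk ?_))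
    rw [hn]
    exact Nat.sub_le_sub_left (hmin g) n
  choose C hC using hup
  have := Fintype.ofFinite (G ⧸ N)
  have hidx : (0 : ℝ) < N.index := by
    exact_mod_cast Nat.pos_of_ne_zero Subgroup.FiniteIndex.index_ne_zero
  refine ⟨(N.index : ℝ)⁻¹, (∑ q : G ⧸ N, C q.out : ℕ) + 1, inv_pos.2 hidx, by positivity, 1,
    one_pos, fun k hk => ?_⟩
  obtain ⟨hfin, hle⟩ := finite_range_twistedClass_and_card_le hφN k
    fun g => ((pow_pos hk _).trans_le (hlow g k hk)).ne'
  rw [fQ_eq_card_range]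
  constructor
  · rw [inv_mul_le_iff₀ hidx, mul_comm, hg₀, hM]
    exact_mod_cast (hlow g₀ k hk).trans (index_le_card_twistedClass_mul hφN g₀ k hfin)
  · have hsum : Nat.card (Set.range (twistedClass φ (powSubgroup N k))) ≤
        (∑ q : G ⧸ N, C q.out + 1) * k ^ (n - minTwistRank φ N) := by
      rw [add_mul, Finset.sum_mul]
      rw [finsum_eq_sum_of_fintype] at hle
      exact (hle.trans (Finset.sum_le_sum fun q _ => hC q.out k hk)).trans (Nat.le_add_right _ _)
    exact_mod_cast hsum
end

section
/- Let B ∈ Z^{n×n}, let M_1 = Id, M_2, …, M_k ∈ GL_n(Z) be invertible integer matrices each commuting with B, and let c_1 = 0, c_2, …, c_k ∈ Z^n. For a finite generating set S of Z^n define V^S(r) := { x + Im(B) : ( ⋃_{i=1}^k (M_i x + c_i + Im(B)) ) ∩ B_{Z^n}^S(r) ≠ ∅ }. Then #V^S(r) = Θ(r^{n − rank(B)}) as r → ∞, for every finite generating set S of Z^n. -/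
open Filter Topology
open scoped Pointwise NNReal

/-- The ball of radius `r` in an additive group w.r.t. a generating set `S`:
elements expressible as a sum of at most `r` elements of `S ∪ (-S)`. -/
def addBall {V : Type*} [AddGroup V] (S : Set V) (r : ℕ) : Set V :=
  {v | ∃ l : List V, l.length ≤ r ∧ (∀ x ∈ l, x ∈ S ∪ -S) ∧ l.sum = v}

section Ball

variable {V W : Type*} [AddCommGroup V] [AddCommGroup W]

theorem zero_mem_addBall (S : Set V) (r : ℕ) : (0 : V) ∈ addBall S r :=
  ⟨[], by simp, by simp, by simp⟩

theorem addBall_mono (S : Set V) {r s : ℕ} (h : r ≤ s) : addBall S r ⊆ addBall S s := by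
  rintro v ⟨l, hl, hS, rfl⟩
  exact ⟨l, hl.trans h, hS, rfl⟩

theorem add_mem_addBall {S : Set V} {r s : ℕ} {v w : V} (hv : v ∈ addBall S r)
    (hw : w ∈ addBall S s) : v + w ∈ addBall S (r + s) := by
  obtain ⟨l, hl, hlS, rfl⟩ := hv
  obtain ⟨m, hm, hmS, rfl⟩ := hw
  refine ⟨l ++ m, by simpa using add_le_add hl hm, fun x hx => ?_, List.sum_append⟩
  exact (List.mem_append.1 hx).elim (hlS x) (hmS x)

theorem neg_mem_addBall {S : Set V} {r : ℕ} {v : V} (hv : v ∈ addBall S r) :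
    -v ∈ addBall S r := by
  obtain ⟨l, hl, hlS, rfl⟩ := hv
  refine ⟨l.map Neg.neg, by simpa using hl, fun x hx => ?_, ?_⟩
  · obtain ⟨y, hy, rfl⟩ := List.mem_map.1 hx
    have := hlS y hy
    simpa [or_comm] using this
  · induction l with
    | nil => simp
    | cons a l ih =>
      have := ih (by simp at hl; omega) fun x hx => hlS x (List.mem_cons_of_mem _ hx)
      simp [this, add_comm]

theorem nsmul_mem_addBall {S : Set V} {r : ℕ} {v : V} (hv : v ∈ addBall S r) (m : ℕ) :
    m • v ∈ addBall S (m * r) := by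
  induction m with
  | zero => simpa using zero_mem_addBall S 0
  | succ m ih => simpa [add_smul, add_mul] using add_mem_addBall ih hv

theorem sum_mem_addBall {ι : Type*} {S : Set V} {r : ℕ} (s : Finset ι) {v : ι → V}
    (hv : ∀ i ∈ s, v i ∈ addBall S r) : ∑ i ∈ s, v i ∈ addBall S (s.card * r) := by
  classical
  induction s using Finset.induction_on with
  | empty => simpa using zero_mem_addBall S 0
  | insert a s ha ih =>
    rw [Finset.sum_insert ha, Finset.card_insert_of_notMem ha, add_mul, one_mul, add_comm (_ * r)]
    exact add_mem_addBall (hv a (by simp)) (ih fun i hi => hv i (by simp [hi]))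

theorem exists_mem_addBall {S : Set V} (hS : AddSubgroup.closure S = ⊤) (v : V) :
    ∃ r, v ∈ addBall S r := by
  have hv : v ∈ AddSubgroup.closure S := hS ▸ AddSubgroup.mem_top v
  induction hv using AddSubgroup.closure_induction with
  | mem x hx => exact ⟨1, [x], by simp, by simp [hx], by simp⟩
  | zero => exact ⟨0, zero_mem_addBall S 0⟩
  | add x y _ _ hx hy =>
    obtain ⟨r, hr⟩ := hx
    obtain ⟨s, hs⟩ := hy
    exact ⟨r + s, add_mem_addBall hr hs⟩
  | neg x _ hx =>
    obtain ⟨r, hr⟩ := hx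
    exact ⟨r, neg_mem_addBall hr⟩

theorem finite_addBall {S : Set V} (hS : S.Finite) (r : ℕ) : (addBall S r).Finite := by
  have : Finite ↥(S ∪ -S) := (hS.union hS.neg).to_subtype
  refine ((List.finite_length_le ↥(S ∪ -S) r).image fun l => (l.map (↑)).sum).subset ?_
  rintro v ⟨l, hl, hlS, rfl⟩
  lift l to List ↥(S ∪ -S) using hlS
  exact ⟨l, by simpa using hl, rfl⟩

theorem image_addBall (f : V →+ W) (S : Set V) (r : ℕ) :
    f '' addBall S r = addBall (f '' S) r := by
  have himage : f '' (S ∪ -S) = f '' S ∪ -(f '' S) := by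
    rw [Set.image_union, Set.image_neg_of_apply_neg_eq_neg fun x _ => map_neg f x]
  ext w
  constructor
  · rintro ⟨_, ⟨l, hl, hlS, rfl⟩, rfl⟩
    refine ⟨l.map f, by simpa using hl, fun x hx => ?_, (map_list_sum f l).symm⟩
    obtain ⟨y, hy, rfl⟩ := List.mem_map.1 hx
    exact himage ▸ Set.mem_image_of_mem f (hlS y hy)
  · rintro ⟨l, hl, hlS, rfl⟩
    rw [← himage] at hlS
    choose! g hg hfg using hlS
    refine ⟨(l.map g).sum, ⟨l.map g, by simpa using hl, fun x hx => ?_, rfl⟩, ?_⟩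
    · obtain ⟨y, hy, rfl⟩ := List.mem_map.1 hx
      exact hg y hy
    · rw [map_list_sum, List.map_map, List.map_congr_left (f := f ∘ g) (g := id) hfg, List.map_id]

theorem abs_apply_le_of_mem_addBall (f : V →+ ℤ) {S : Set V} {L : ℤ}
    (hL : ∀ s ∈ S, |f s| ≤ L) {r : ℕ} (hL0 : 0 ≤ L) {v : V} (hv : v ∈ addBall S r) :
    |f v| ≤ r * L := by
  obtain ⟨l, hl, hlS, rfl⟩ := hv
  have hlen : |f l.sum| ≤ l.length * L := by
    clear hl
    induction l with
    | nil => simp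
    | cons a l ih =>
      have h := ih fun x hx => hlS x (List.mem_cons_of_mem _ hx)
      have ha : |f a| ≤ L := by
        rcases hlS a List.mem_cons_self with ha | ha
        · exact hL a ha
        · simpa using hL (-a) ha
      rw [List.sum_cons, map_add, List.length_cons]
      push_cast
      linarith [abs_add_le (f a) (f l.sum)]
  exact hlen.trans (mul_le_mul_of_nonneg_right (by exact_mod_cast hl) hL0)

end Ball

section Growth

variable {Q : Type*} [AddCommGroup Q] [Module.Finite ℤ Q]

/-- A finitely generated abelian group surjects onto a free one of the same rank with finite
kernel. -/
theorem exists_surjective_finite_ker {d : ℕ} (hd : Module.finrank ℤ Q = d) :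
    ∃ f : Q →ₗ[ℤ] (Fin d → ℤ), Function.Surjective f ∧ Finite (LinearMap.ker f) := by
  let T := Submodule.torsion ℤ Q
  have hrank : Module.finrank ℤ (Q ⧸ T) = d :=
    (finrank_quotient_eq_of_le_torsion le_rfl).trans hd
  let e := (Module.finBasisOfFinrankEq ℤ (Q ⧸ T) hrank).equivFun
  refine ⟨e.toLinearMap ∘ₗ T.mkQ, e.surjective.comp T.mkQ_surjective, ?_⟩
  rw [LinearEquiv.ker_comp, Submodule.ker_mkQ]
  exact Module.finite_of_fg_torsion T (Submodule.torsion_isTorsion)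

theorem exists_pow_le_ncard_addBall {d : ℕ} (hd : Module.finrank ℤ Q = d) {S : Set Q}
    (hfin : S.Finite) (hgen : AddSubgroup.closure S = ⊤) :
    ∃ K : ℕ, 0 < K ∧ ∀ r, r ^ d ≤ K ^ d * (addBall S r).ncard := by
  obtain ⟨f, hf, -⟩ := exists_surjective_finite_ker hd
  choose v hv using fun j : Fin d => hf (Pi.single j 1)
  choose L hL using fun j => exists_mem_addBall hgen (v j)
  set R := ∑ j, L j
  have hR : ∀ j, v j ∈ addBall S R := fun j =>
    addBall_mono S (Finset.single_le_sum (fun _ _ => Nat.zero_le _) (Finset.mem_univ j)) (hL j)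
  refine ⟨d * R + 1, Nat.succ_pos _, fun r => ?_⟩
  set m := r / (d * R + 1)
  let φ : (Fin d → Fin (m + 1)) → Q := fun a => ∑ j, (a j : ℕ) • v j
  have hfφ : ∀ a j, f (φ a) j = (a j : ℕ) := fun a j => by
    simp [φ, hv, Finset.sum_apply, Pi.single_apply]
  have hinj : Function.Injective φ := fun a b hab => by
    ext j
    have := hfφ a j
    rw [hab, hfφ b j] at this
    exact_mod_cast this.symm
  have hmaps : Set.range φ ⊆ addBall S r := by
    rintro _ ⟨a, rfl⟩
    refine addBall_mono S ?_ (sum_mem_addBall Finset.univ (r := m * R) fun j _ =>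
      addBall_mono S (Nat.mul_le_mul_right R (Nat.lt_succ_iff.1 (a j).2))
        (nsmul_mem_addBall (hR j) (a j)))
    calc _ = m * (d * R) := by simp; ring
      _ ≤ m * (d * R + 1) := by gcongr; omega
      _ ≤ r := Nat.div_mul_le_self _ _
  have hcard : (m + 1) ^ d ≤ (addBall S r).ncard := by
    have := Set.ncard_le_ncard hmaps (finite_addBall hfin r)
    rwa [← Set.image_univ, Set.ncard_image_of_injective _ hinj, Set.ncard_univ, Nat.card_fun,
      Nat.card_fin, Nat.card_fin] at this
  calc r ^ d ≤ ((d * R + 1) * (m + 1)) ^ d := by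
        gcongr
        exact (Nat.lt_mul_div_succ r (Nat.succ_pos _)).le
    _ = (d * R + 1) ^ d * (m + 1) ^ d := mul_pow _ _ _
    _ ≤ _ := by gcongr

theorem exists_ncard_addBall_le_pow {d : ℕ} (hd : Module.finrank ℤ Q = d) {S : Set Q}
    (hfin : S.Finite) :
    ∃ K : ℕ, 0 < K ∧ ∀ r, 0 < r → (addBall S r).ncard ≤ K * r ^ d := by
  obtain ⟨f, -, hker⟩ := exists_surjective_finite_ker hd
  have hb : ∃ L : ℕ, ∀ s ∈ S, ∀ j, |f s j| ≤ L := by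
    obtain ⟨L, hL⟩ := (hfin.image fun s => ∑ j, (f s j).natAbs).bddAbove
    refine ⟨L, fun s hs j => ?_⟩
    rw [Int.abs_eq_natAbs]
    exact_mod_cast (Finset.single_le_sum (f := fun j => (f s j).natAbs)
      (fun _ _ => Nat.zero_le _) (Finset.mem_univ j)).trans (hL ⟨s, hs, rfl⟩)
  obtain ⟨L, hL⟩ := hb
  refine ⟨Nat.card (LinearMap.ker f) * (2 * L + 1) ^ d, Nat.mul_pos Nat.card_pos (by positivity),
    fun r hr => ?_⟩
  have hball := finite_addBall hfin r
  let box : Finset (Fin d → ℤ) := Fintype.piFinset fun _ => Finset.Icc (-(r * L : ℤ)) (r * L)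
  have hmaps : ∀ q ∈ hball.toFinset, f q ∈ box := fun q hq => by
    refine Fintype.mem_piFinset.2 fun j => Finset.mem_Icc.2 (abs_le.1 ?_)
    exact abs_apply_le_of_mem_addBall
      ((LinearMap.proj j ∘ₗ f : Q →ₗ[ℤ] ℤ).toAddMonoidHom) (fun s hs => hL s hs j)
      (Nat.cast_nonneg L) (hball.mem_toFinset.1 hq)
  have hfib : ∀ b ∈ box, {q ∈ hball.toFinset | f q = b}.card ≤ Nat.card (LinearMap.ker f) := by
    intro b _
    rcases Finset.eq_empty_or_nonempty {q ∈ hball.toFinset | f q = b} with h | ⟨p, hp⟩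
    · simp [h]
    · have := Fintype.ofFinite (LinearMap.ker f)
      rw [Nat.card_eq_fintype_card, ← Fintype.card_coe]
      refine Fintype.card_le_of_injective (fun q => ⟨q.1 - p, ?_⟩) fun q q' h => ?_
      · rw [LinearMap.mem_ker, map_sub, (Finset.mem_filter.1 q.2).2, (Finset.mem_filter.1 hp).2,
          sub_self]
      · exact Subtype.ext (sub_left_injective (congrArg Subtype.val h))
  have hbox : box.card = (2 * (r * L) + 1) ^ d := by
    simp only [box, Fintype.card_piFinset, Int.card_Icc, Finset.prod_const, Finset.card_univ,
      Fintype.card_fin]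
    congr 1
    omega
  calc (addBall S r).ncard = hball.toFinset.card := Set.ncard_eq_toFinset_card _ hball
    _ ≤ Nat.card (LinearMap.ker f) * box.card :=
      Finset.card_le_mul_card_image_of_maps_to hmaps _ hfib
    _ = Nat.card (LinearMap.ker f) * (2 * (r * L) + 1) ^ d := by rw [hbox]
    _ ≤ Nat.card (LinearMap.ker f) * ((2 * L + 1) * r) ^ d := by
      gcongr
      nlinarith
    _ = _ := by rw [mul_pow, mul_assoc]

end Growth

/-- **Coset counting in `ℤⁿ` for finite unions of translated cosets.** -/
theorem coset_counting_Zn_union (n k : ℕ) (hk : 0 < k) (B : Matrix (Fin n) (Fin n) ℤ)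
    (M : Fin k → Matrix (Fin n) (Fin n) ℤ) (c : Fin k → Fin n → ℤ)
    (hM1 : M ⟨0, hk⟩ = 1) (hc1 : c ⟨0, hk⟩ = 0)
    (hMinv : ∀ i, IsUnit (M i))
    (hMB : ∀ i, M i * B = B * M i)
    (S : Set (Fin n → ℤ)) (hSfin : S.Finite) (hSgen : AddSubgroup.closure S = ⊤) :
    IsThetaNat
      (fun r => Nat.card {C : Set (Fin n → ℤ) |
        ∃ x : Fin n → ℤ, C = {y | y - x ∈ LinearMap.range B.mulVecLin} ∧
          ∃ i : Fin k, ∃ y ∈ addBall S r,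
            y - ((M i).mulVec x + c i) ∈ LinearMap.range B.mulVecLin})
      (fun r => r ^ (n - B.rank)) := by
  set N := LinearMap.range B.mulVecLin with hN
  let π : (Fin n → ℤ) →+ (Fin n → ℤ) ⧸ N := N.mkQ.toAddMonoidHom
  have hπ : Function.Surjective π := N.mkQ_surjective
  have hπ_eq : ∀ x y, π x = π y ↔ x - y ∈ N := fun x y => Submodule.Quotient.eq N
  have hrank : n - B.rank = Module.finrank ℤ ((Fin n → ℤ) ⧸ N) := by
    have := N.finrank_quotient_add_finrank
    rw [Module.finrank_fin_fun] at this
    rw [Matrix.rank, ← hN]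
    omega
  have hgen : AddSubgroup.closure (π '' S) = ⊤ := by
    rw [← AddMonoidHom.map_closure, hSgen, ← AddMonoidHom.range_eq_map,
      AddMonoidHom.range_eq_top.2 hπ]
  have hfin := hSfin.image π
  have hmem : ∀ i x y, π ((M i).mulVec x) = π ((M i).mulVec y) ↔ π x = π y := by
    intro i x y
    rw [hπ_eq, hπ_eq, ← Matrix.mulVec_sub]
    generalize x - y = z
    obtain ⟨U, hU⟩ := hMinv i
    constructor
    · rintro ⟨w, hw⟩
      refine ⟨(↑U⁻¹ : Matrix (Fin n) (Fin n) ℤ).mulVec w, ?_⟩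
      have hcomm : B * (↑U⁻¹ : Matrix (Fin n) (Fin n) ℤ) =
          (↑U⁻¹ : Matrix (Fin n) (Fin n) ℤ) * B := by
        rw [Units.eq_inv_mul_iff_mul_eq, ← mul_assoc, hU, hMB, mul_assoc, ← hU, Units.mul_inv,
          mul_one]
      rw [Matrix.mulVecLin_apply] at hw
      rw [Matrix.mulVecLin_apply, Matrix.mulVec_mulVec, hcomm, ← Matrix.mulVec_mulVec, hw, ← hU,
        Matrix.mulVec_mulVec, Units.inv_mul, Matrix.one_mulVec]
    · rintro ⟨w, rfl⟩
      exact ⟨(M i).mulVec w, by simp [Matrix.mulVec_mulVec, hMB]⟩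
  -- The coset `x + Im B`, identified with the class of `x`, moves to `M i x + c i + Im B`.
  let h : Fin k → (Fin n → ℤ) ⧸ N → (Fin n → ℤ) ⧸ N := fun i q =>
    π ((M i).mulVec (Function.surjInv hπ q)) + π (c i)
  have hh : ∀ i x, h i (π x) = π ((M i).mulVec x + c i) := fun i x => by
    rw [map_add, ← (hmem i _ x).2 (Function.surjInv_eq hπ (π x))]
  have hinj : ∀ i, Function.Injective (h i) := fun i p q hpq => by
    obtain ⟨x, rfl⟩ := hπ p
    obtain ⟨y, rfl⟩ := hπ q
    rw [hh, hh, map_add, map_add] at hpq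
    exact (hmem i x y).1 (add_right_cancel hpq)
  have hcard : ∀ r, Nat.card {C : Set (Fin n → ℤ) | ∃ x : Fin n → ℤ, C = {y | y - x ∈ N} ∧
      ∃ i : Fin k, ∃ y ∈ addBall S r, y - ((M i).mulVec x + c i) ∈ N} =
      (⋃ i, h i ⁻¹' addBall (π '' S) r).ncard := by
    intro r
    have hcoset : Function.Injective fun q => π ⁻¹' {q} :=
      (Set.preimage_injective.2 hπ).comp Set.singleton_injective
    rw [Nat.card_coe_set_eq, ← Set.ncard_image_of_injective _ hcoset]
    congr 1
    have hball : ∀ i x, h i (π x) ∈ addBall (π '' S) r ↔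
        ∃ y ∈ addBall S r, y - ((M i).mulVec x + c i) ∈ N := fun i x => by
      simp only [← image_addBall, hh, Set.mem_image, hπ_eq]
    have hpre : ∀ x, π ⁻¹' {π x} = {y | y - x ∈ N} := fun x => Set.ext fun y => hπ_eq y x
    ext C
    simp only [Set.mem_ofPred_eq, Set.mem_image, Set.mem_iUnion, Set.mem_preimage, hπ.exists,
      hball, hpre]
    exact exists_congr fun x => by rw [and_comm, eq_comm]
  have hfinite : ∀ r i, (h i ⁻¹' addBall (π '' S) r).Finite := fun r i =>
    (finite_addBall hfin r).preimage (hinj i).injOn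
  obtain ⟨K₁, hK₁, hlow⟩ := exists_pow_le_ncard_addBall hrank.symm hfin hgen
  obtain ⟨K₂, hK₂, hup⟩ := exists_ncard_addBall_le_pow hrank.symm hfin
  refine ⟨((K₁ : ℝ) ^ (n - B.rank))⁻¹, (k * K₂ : ℕ), by positivity, by positivity, 1, one_pos,
    fun r hr => ?_⟩
  dsimp only
  rw [hcard r]
  constructor
  · rw [inv_mul_le_iff₀ (by positivity)]
    have hid : h ⟨0, hk⟩ = id := funext fun q => by
      obtain ⟨x, rfl⟩ := hπ q
      simp [hh, hM1, hc1]
    have hsub : addBall (π '' S) r ⊆ ⋃ i, h i ⁻¹' addBall (π '' S) r := fun q hq =>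
      Set.mem_iUnion.2 ⟨⟨0, hk⟩, by rwa [hid]⟩
    exact_mod_cast (hlow r).trans
      (Nat.mul_le_mul_left _ (Set.ncard_le_ncard hsub (Set.finite_iUnion (hfinite r))))
  · have hunion : (⋃ i, h i ⁻¹' addBall (π '' S) r).ncard ≤ k * (addBall (π '' S) r).ncard := by
      calc _ ≤ ∑ i, (h i ⁻¹' addBall (π '' S) r).ncard := Set.ncard_iUnion_le_of_fintype _
        _ ≤ ∑ _i : Fin k, (addBall (π '' S) r).ncard := Finset.sum_le_sum fun i _ => by
          rw [← Set.ncard_image_of_injective _ (hinj i)]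
          exact Set.ncard_le_ncard (Set.image_preimage_subset _ _) (finite_addBall hfin r)
        _ = _ := by simp
    rw [← Nat.cast_mul, Nat.cast_le, mul_assoc]
    exact hunion.trans (Nat.mul_le_mul_left k (hup r hr))
end

section
/- Let G be a finitely generated virtually abelian group, N ⊴_fin G a torsion-free abelian normal subgroup of finite index, and φ ∈ End(G) with φ(N) ⊆ N. Fix a finite set A ⊆ G of coset representatives of G/N containing 1_G. Then for any a ∈ A and any x, y ∈ N: xa is φ-twisted conjugate to ya in G if and only if x ∈ ⋃_{c ∈ E^a} ( τ_c(y) − (τ_a ∘ φ^a)(c) + Im(Id_N − (τ_a ∘ φ)|_N) ), where the union and arithmetic take place in the abelian group N written additively. -/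
open Filter Topology
open scoped Pointwise NNReal

/-- For `N` abelian, normal and `φ`-invariant, every element of `twistImage φ N g` has the form
`n * (g * φ n * g⁻¹)⁻¹` with `n ∈ N`. -/
theorem mem_twistImage_iff {G : Type*} [Group G] {φ : G →* G} {N : Subgroup G}
    (hNnorm : N.Normal) (hNab : ∀ x ∈ N, ∀ y ∈ N, x * y = y * x)
    (hφN : ∀ x ∈ N, φ x ∈ N) {g u : G} :
    u ∈ twistImage φ N g ↔ ∃ n ∈ N, u = n * (g * φ n * g⁻¹)⁻¹ := by
  refine ⟨fun hu => ?_, fun hu => Subgroup.subset_closure hu⟩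
  have hconj : ∀ n ∈ N, (g * φ n * g⁻¹)⁻¹ ∈ N := fun n hn =>
    N.inv_mem (hNnorm.conj_mem _ (hφN n hn) g)
  induction hu using Subgroup.closure_induction with
  | mem v hv => exact hv
  | one => exact ⟨1, N.one_mem, by simp⟩
  | mul v w _ _ hv hw =>
    obtain ⟨n, hn, rfl⟩ := hv
    obtain ⟨m, hm, rfl⟩ := hw
    refine ⟨n * m, N.mul_mem hn hm, ?_⟩
    calc n * (g * φ n * g⁻¹)⁻¹ * (m * (g * φ m * g⁻¹)⁻¹)
        = n * ((g * φ n * g⁻¹)⁻¹ * (m * (g * φ m * g⁻¹)⁻¹)) := by group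
      _ = n * (m * (g * φ m * g⁻¹)⁻¹ * (g * φ n * g⁻¹)⁻¹) := by
          rw [hNab _ (hconj n hn) _ (N.mul_mem hm (hconj m hm))]
      _ = n * m * (g * φ (n * m) * g⁻¹)⁻¹ := by rw [map_mul]; group
  | inv v _ hv =>
    obtain ⟨n, hn, rfl⟩ := hv
    refine ⟨n⁻¹, N.inv_mem hn, ?_⟩
    rw [mul_inv_rev, hNab _ (N.inv_mem (hconj n hn)) _ (N.inv_mem hn), map_inv]
    group

/-- **Twisted conjugacy inside a coset of `N` is a finite union of cosets of
`Im(Id_N − (τ_a ∘ φ)|_N)`.** Here `E^a = {c ∈ A : p(a) = p(c a φ(c)⁻¹)}`,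
`φ^a(c) = φ(c) a⁻¹ c⁻¹ a`, so `τ_a(φ^a(c)) = a φ(c) a⁻¹ c⁻¹`, and multiplicative notation is
used for the arithmetic in the abelian group `N`. -/
theorem twisted_conjugacy_in_coset {G : Type*} [Group G] (hG : Group.FG G)
    (N : Subgroup G) (hNnorm : N.Normal) (hNfin : N.FiniteIndex)
    (hNab : ∀ x ∈ N, ∀ y ∈ N, x * y = y * x)
    (hNtf : ∀ x ∈ N, ∀ k : ℕ, 0 < k → x ^ k = 1 → x = 1)
    (φ : G →* G) (hφN : ∀ x ∈ N, φ x ∈ N)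
    (A : Finset G) (hA1 : (1 : G) ∈ A)
    (hArep : ∀ g : G, ∃ a ∈ A, a⁻¹ * g ∈ N)
    (hAuniq : ∀ a ∈ A, ∀ b ∈ A, a⁻¹ * b ∈ N → a = b)
    (a : G) (ha : a ∈ A) (x y : G) (hx : x ∈ N) (hy : y ∈ N) :
    TwistedConj φ (x * a) (y * a) ↔
      ∃ c ∈ A, a⁻¹ * (c * a * (φ c)⁻¹) ∈ N ∧
        ∃ u ∈ twistImage φ N a,
          x = (c * y * c⁻¹) * (a * φ c * a⁻¹ * c⁻¹)⁻¹ * u := by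
  have hmem : ∀ c : G, a⁻¹ * (c * a * (φ c)⁻¹) ∈ N ↔ (a * φ c * a⁻¹ * c⁻¹)⁻¹ ∈ N := by
    intro c
    rw [hNnorm.mem_comm_iff]
    simp only [mul_inv_rev, inv_inv, mul_assoc]
  have hrearrange : ∀ c n : G, n ∈ N → (a * φ c * a⁻¹ * c⁻¹)⁻¹ ∈ N →
      n * c * (y * a) * (φ (n * c))⁻¹ =
        (c * y * c⁻¹) * (a * φ c * a⁻¹ * c⁻¹)⁻¹ * (n * (a * φ n * a⁻¹)⁻¹) * a := by
    intro c n hn hc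
    rw [← mul_assoc _ n, ← hNab n hn _ (N.mul_mem (hNnorm.conj_mem y hy c) hc), map_mul]
    group
  constructor
  · rintro ⟨z, hz⟩
    obtain ⟨c, hcA, hcz⟩ := hArep z
    obtain ⟨n, hn, rfl⟩ : ∃ n ∈ N, z = n * c :=
      ⟨z * c⁻¹, hNnorm.mem_comm hcz, by group⟩
    have hc : (a * φ c * a⁻¹ * c⁻¹)⁻¹ ∈ N := by
      have h : (a * φ c * a⁻¹ * c⁻¹)⁻¹ =
          (n * (c * y * c⁻¹))⁻¹ * x * (a * φ n * a⁻¹) := by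
        rw [eq_mul_inv_of_mul_eq hz, map_mul]
        group
      rw [h]
      exact N.mul_mem (N.mul_mem (N.inv_mem (N.mul_mem hn (hNnorm.conj_mem y hy c))) hx)
        (hNnorm.conj_mem _ (hφN n hn) a)
    exact ⟨c, hcA, (hmem c).2 hc, _, Subgroup.subset_closure ⟨n, hn, rfl⟩,
      mul_right_cancel (hz.trans (hrearrange c n hn hc))⟩
  · rintro ⟨c, -, hc, u, hu, hxu⟩
    obtain ⟨n, hn, rfl⟩ := (mem_twistImage_iff hNnorm hNab hφN).1 hu
    exact ⟨n * c, by rw [hxu, hrearrange c n hn ((hmem c).1 hc)]⟩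
end

section
/- Let H be a nonzero subgroup of Z^n, let k, l ∈ ℕ_{>0}, set r := rank(H), and fix a Z-basis {v_1, …, v_r} of H. If l·v_r ∈ ⟨v_1, …, v_{r−1}⟩ + (kZ)^n (interpreted as l·v_1 ∈ (kZ)^n when r = 1), then k ≤ |√H / H| · l, where √H := { z ∈ Z^n : ∃ m ∈ ℕ_{>0}, m·z ∈ H } is the isolator subgroup of H. -/
open Filter Topology
open scoped Pointwise NNReal

/-- The subgroup `(kℤ)ⁿ` of `ℤⁿ`: vectors all of whose coordinates are divisible by `k`. -/
noncomputable def kZn (n k : ℕ) : AddSubgroup (Fin n → ℤ) :=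
  AddSubgroup.pi Set.univ (fun _ => AddSubgroup.zmultiples (k : ℤ))

/-- The isolator subgroup `√H = {z ∈ ℤⁿ : ∃ m > 0, m·z ∈ H}` of a subgroup `H` of `ℤⁿ`. -/
def isolator {n : ℕ} (H : AddSubgroup (Fin n → ℤ)) : AddSubgroup (Fin n → ℤ) where
  carrier := {z | ∃ m : ℕ, 0 < m ∧ m • z ∈ H}
  zero_mem' := ⟨1, Nat.one_pos, by simpa using H.zero_mem⟩
  add_mem' := by
    rintro a b ⟨m, hm, hma⟩ ⟨m', hm', hmb⟩
    refine ⟨m * m', Nat.mul_pos hm hm', ?_⟩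
    rw [smul_add]
    exact H.add_mem
      (by rw [mul_comm, mul_smul]; exact AddSubgroup.nsmul_mem H hma m')
      (by rw [mul_smul]; exact AddSubgroup.nsmul_mem H hmb m)
  neg_mem' := by
    rintro a ⟨m, hm, hma⟩
    exact ⟨m, hm, by rw [smul_neg]; exact H.neg_mem hma⟩

/-- A vector lies in the isolator of `H` as soon as some positive multiple of it lies in `H`. -/
theorem mem_isolator_of_nsmul_mem {n : ℕ} {H : AddSubgroup (Fin n → ℤ)} {m : ℕ} (hm : 0 < m)
    {z : Fin n → ℤ} (hz : m • z ∈ H) : z ∈ isolator H :=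
  ⟨m, hm, hz⟩

/-- `√H / H` is a finitely generated torsion group, hence finite. -/
theorem index_addSubgroupOf_isolator_ne_zero {n : ℕ} (H : AddSubgroup (Fin n → ℤ)) :
    (H.addSubgroupOf (isolator H)).index ≠ 0 := by
  have hfin : Module.Finite ℤ (isolator H) :=
    inferInstanceAs (Module.Finite ℤ (AddSubgroup.toIntSubmodule (isolator H)))
  have hquot : Module.Finite ℤ (isolator H ⧸ H.addSubgroupOf (isolator H)) :=
    Module.Finite.of_surjective
      (QuotientAddGroup.mk' (H.addSubgroupOf (isolator H))).toIntLinearMap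
      (QuotientAddGroup.mk'_surjective _)
  have htors : Module.IsTorsion ℤ (isolator H ⧸ H.addSubgroupOf (isolator H)) := by
    intro x
    obtain ⟨⟨z, m, hm, hz⟩, rfl⟩ := QuotientAddGroup.mk_surjective x
    refine ⟨⟨(m : ℤ), mem_nonZeroDivisors_of_ne_zero (by exact_mod_cast hm.ne')⟩, ?_⟩
    rw [Submonoid.mk_smul, natCast_zsmul, ← QuotientAddGroup.mk_nsmul,
      QuotientAddGroup.eq_zero_iff]
    exact hz
  have : Finite (isolator H ⧸ H.addSubgroupOf (isolator H)) :=
    Module.finite_of_fg_torsion _ htors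
  exact AddSubgroup.index_ne_zero_of_finite

/-- Multiplication by the index `|√H / H|` maps the isolator of `H` into `H`. -/
theorem index_nsmul_mem_of_mem_isolator {n : ℕ} {H : AddSubgroup (Fin n → ℤ)}
    {z : Fin n → ℤ} (hz : z ∈ isolator H) :
    (H.addSubgroupOf (isolator H)).index • z ∈ H :=
  AddSubgroup.nsmul_index_mem (H := H.addSubgroupOf (isolator H)) ⟨z, hz⟩

/-- Elements of `(kℤ)ⁿ` are `k`-multiples of vectors. -/
theorem exists_nsmul_eq_of_mem_kZn {n k : ℕ} {x : Fin n → ℤ} (hx : x ∈ kZn n k) :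
    ∃ z : Fin n → ℤ, k • z = x := by
  have h : ∀ i, ∃ c : ℤ, c • (k : ℤ) = x i := fun i =>
    AddSubgroup.mem_zmultiples_iff.mp (hx i (Set.mem_univ i))
  choose z hz using h
  refine ⟨z, funext fun i => ?_⟩
  simp [← hz i, mul_comm]

/-- An element of the span of a family is a multiple of any given member plus a combination
of the others. -/
theorem exists_sub_smul_mem_span_of_mem_span_range {R M ι : Type*} [Ring R] [AddCommGroup M]
    [Module R M] (v : ι → M) (j : ι) {x : M} (hx : x ∈ Submodule.span R (Set.range v)) :
    ∃ a : R, x - a • v j ∈ Submodule.span R (v '' (Set.univ \ {j})) := by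
  have hrange : Set.range v = insert (v j) (v '' (Set.univ \ {j})) := by
    rw [← Set.image_insert_eq, Set.insert_sdiff_singleton, Set.insert_eq_of_mem (Set.mem_univ j),
      Set.image_univ]
  rw [hrange, Submodule.mem_span_insert] at hx
  obtain ⟨a, y, hy, rfl⟩ := hx
  exact ⟨a, by simpa using hy⟩

/-- **Bound on `k`.** If `{v_1, …, v_r}` is a `ℤ`-basis of the nonzero subgroup `H ⊆ ℤⁿ` and
`l·v_r ∈ ⟨v_1, …, v_{r−1}⟩ + (kℤ)ⁿ`, then `k ≤ |√H / H| · l`. -/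
theorem k_le_isolator_index_mul (n : ℕ) (H : AddSubgroup (Fin n → ℤ)) (hH : H ≠ ⊥)
    (k l : ℕ) (hk : 0 < k) (hl : 0 < l)
    (r : ℕ) (hr : 0 < r) (v : Fin r → Fin n → ℤ)
    (hvH : ∀ i, v i ∈ H) (hvli : LinearIndependent ℤ v)
    (hvspan : ∀ x ∈ H, x ∈ Submodule.span ℤ (Set.range v))
    (hcond : l • v ⟨r - 1, by omega⟩ ∈
      AddSubgroup.closure (v '' {i : Fin r | (i : ℕ) < r - 1}) ⊔ kZn n k) :
    k ≤ (H.addSubgroupOf (isolator H)).index * l := by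
  set N := (H.addSubgroupOf (isolator H)).index
  set j : Fin r := ⟨r - 1, by omega⟩
  obtain ⟨w, hw, y, hy, hwy⟩ := AddSubgroup.mem_sup.mp hcond
  obtain ⟨z, rfl⟩ := exists_nsmul_eq_of_mem_kZn hy
  have hwH : w ∈ H :=
    (AddSubgroup.closure_le H).mpr (Set.image_subset_iff.mpr fun i _ => hvH i) hw
  have hkz : k • z ∈ H := by
    rw [eq_sub_of_add_eq' hwy]
    exact H.sub_mem (H.nsmul_mem (hvH j) l) hwH
  have hNz : N • z ∈ H := index_nsmul_mem_of_mem_isolator (mem_isolator_of_nsmul_mem hk hkz)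
  obtain ⟨a, ha⟩ := exists_sub_smul_mem_span_of_mem_span_range v j (hvspan _ hNz)
  have hwspan : w ∈ Submodule.span ℤ (v '' (Set.univ \ {j})) := by
    have hle : AddSubgroup.closure (v '' {i : Fin r | (i : ℕ) < r - 1}) ≤
        (Submodule.span ℤ (v '' (Set.univ \ {j}))).toAddSubgroup := by
      refine (AddSubgroup.closure_le _).mpr (Set.image_subset_iff.mpr fun i hi => ?_)
      refine Submodule.subset_span (Set.mem_image_of_mem v ⟨Set.mem_univ i, ?_⟩)
      rintro rfl
      exact lt_irrefl (r - 1) hi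
    exact hle hw
  have hcoeff : ((N : ℤ) * l - k * a) • v j ∈ Submodule.span ℤ (v '' (Set.univ \ {j})) := by
    have heq : ((N : ℤ) * l - k * a) • v j = (N : ℤ) • w + (k : ℤ) • (N • z - a • v j) := by
      rw [sub_smul, mul_smul, natCast_zsmul (v j) l, ← hwy]
      module
    rw [heq]
    exact Submodule.add_mem _ (Submodule.smul_mem _ _ hwspan) (Submodule.smul_mem _ _ ha)
  have hzero := linearIndependent_iff_eq_zero_of_smul_mem_span.mp hvli j _ hcoeff
  have hdvd : k ∣ N * l := by
    have : (k : ℤ) ∣ ((N * l : ℕ) : ℤ) := ⟨a, by push_cast; linarith⟩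
    exact_mod_cast this
  exact Nat.le_of_dvd
    (Nat.mul_pos (Nat.pos_of_ne_zero (index_addSubgroupOf_isolator_ne_zero H)) hl) hdvd
end
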